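/- Let d ≥ 2 and let B ⊆ A be linear subspaces of ℝ^d with dim B = b and dim A = a, where 1 ≤ b ≤ c < a ≤ d and b < d. Suppose the Diophantine exponent ω(B) = ω is finite. Then for Lebesgue-almost every Θ ∈ ℝ^{(a−c)×c}, the c-dimensional subspace C(Θ) ⊂ A satisfies ω(C(Θ)) ≤ ω + (ω+1)(c−b)/(a−c) = (ω(a−b) + c − b)/(a−c). -/

import Mathlib

open MeasureTheory Filter

noncomputable section

/-- The sup-norm of a vector in Euclidean space. -/
def supNorm {d : ℕ} (w : EuclideanSpace ℝ (Fin d)) : ℝ := ⨆ i, |w i|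

/-- The point of `ℝ^d` (with Euclidean metric) corresponding to an integer vector. -/
def intVec {d : ℕ} (z : Fin d → ℤ) : EuclideanSpace ℝ (Fin d) :=
  (WithLp.equiv 2 (Fin d → ℝ)).symm (fun i => (z i : ℝ))

/-- The irrationality measure function `ψ_B` of a linear subspace of `ℝ^d`:
`ψ_B(t) = inf { dist(z, B) : z ∈ ℤ^d, 1 ≤ |z| < t }`. -/
def psiSub {d : ℕ} (B : Submodule ℝ (EuclideanSpace ℝ (Fin d))) (t : ℝ) : ℝ :=
  sInf ((fun z : Fin d → ℤ =>
      Metric.infDist (intVec z) (B : Set (EuclideanSpace ℝ (Fin d)))) ''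
    {z | 1 ≤ supNorm (intVec z) ∧ supNorm (intVec z) < t})

/-- The Diophantine exponent of a linear subspace of `ℝ^d`:
`ω(B) = sup { γ : liminf_{t→∞} t^γ ψ_B(t) < ∞ }`, as an extended real number. -/
def diophExp {d : ℕ} (B : Submodule ℝ (EuclideanSpace ℝ (Fin d))) : EReal :=
  sSup {x : EReal | ∃ γ : ℝ, x = (γ : EReal) ∧
    Filter.liminf (fun t : ℝ => ENNReal.ofReal (t ^ γ * psiSub B t)) Filter.atTop < ⊤}

/-- The graph subspace `C(Θ)` of an `(a-c)×c` matrix `Θ`, relative to an orthonormal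
basis `e` of an `a`-dimensional subspace of `ℝ^d`:
`C(Θ) = { ∑ x_j e_j + ∑_i (∑_j θ_{ij} x_j) e_{c+i} : x ∈ ℝ^c }`. -/
def graphSub (d a c : ℕ) (hca : c ≤ a) (e : Fin a → EuclideanSpace ℝ (Fin d))
    (Θ : Fin (a - c) → Fin c → ℝ) : Submodule ℝ (EuclideanSpace ℝ (Fin d)) :=
  Submodule.span ℝ {v | ∃ x : Fin c → ℝ,
    v = (∑ j : Fin c, x j • e (Fin.castLE hca j)) +
        ∑ i : Fin (a - c), (∑ j : Fin c, Θ i j * x j) • e ⟨c + i.1, by have := i.2; omega⟩}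

theorem abs_le_supNorm {d : ℕ} (w : EuclideanSpace ℝ (Fin d)) (i : Fin d) :
    |w i| ≤ supNorm w :=
  le_ciSup (f := fun i => |w i|) (Set.finite_range _).bddAbove i

theorem supNorm_nonneg {d : ℕ} (w : EuclideanSpace ℝ (Fin d)) : 0 ≤ supNorm w :=
  Real.iSup_nonneg fun _ => abs_nonneg _

theorem supNorm_le_norm {d : ℕ} (w : EuclideanSpace ℝ (Fin d)) : supNorm w ≤ ‖w‖ :=
  Real.iSup_le (fun i => by simpa using PiLp.norm_apply_le w i) (norm_nonneg _)

theorem norm_le_mul_supNorm {d : ℕ} (w : EuclideanSpace ℝ (Fin d)) :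
    ‖w‖ ≤ d * supNorm w := by
  have h0 := supNorm_nonneg w
  have h1 : ‖w‖ ≤ ∑ i, |w i| := by
    conv_lhs => rw [← (EuclideanSpace.basisFun (Fin d) ℝ).sum_repr w]
    refine (norm_sum_le _ _).trans (Finset.sum_le_sum fun i _ => ?_)
    simp [norm_smul]
  refine h1.trans ((Finset.sum_le_sum fun i _ => abs_le_supNorm w i).trans ?_)
  simp

@[simp] theorem intVec_apply {d : ℕ} (z : Fin d → ℤ) (i : Fin d) : intVec z i = z i := rfl

theorem intVec_sub {d : ℕ} (z z' : Fin d → ℤ) : intVec (z - z') = intVec z - intVec z' := by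
  ext i; simp

theorem intVec_nsmul {d : ℕ} (n : ℕ) (z : Fin d → ℤ) : intVec (n • z) = (n : ℝ) • intVec z := by
  ext i; simp

theorem supNorm_smul {d : ℕ} (r : ℝ) (w : EuclideanSpace ℝ (Fin d)) :
    supNorm (r • w) = |r| * supNorm w := by
  simp [supNorm, abs_mul, Real.mul_iSup_of_nonneg]

theorem one_le_supNorm_intVec {d : ℕ} {z : Fin d → ℤ} (hz : z ≠ 0) : 1 ≤ supNorm (intVec z) := by
  obtain ⟨i, hi⟩ := Function.ne_iff.mp hz
  refine le_trans ?_ (abs_le_supNorm (intVec z) i)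
  rw [intVec_apply, ← Int.cast_abs]
  exact_mod_cast Int.one_le_abs hi

theorem ne_zero_of_one_le_supNorm {d : ℕ} {z : Fin d → ℤ} (hz : 1 ≤ supNorm (intVec z)) :
    z ≠ 0 := by
  rintro rfl
  simp [supNorm] at hz
  linarith

theorem supNorm_sub_le {d : ℕ} (v w : EuclideanSpace ℝ (Fin d)) :
    supNorm (v - w) ≤ supNorm v + supNorm w :=
  Real.iSup_le (fun i => (abs_sub _ _).trans
    (add_le_add (abs_le_supNorm v i) (abs_le_supNorm w i)))
    (add_nonneg (supNorm_nonneg v) (supNorm_nonneg w))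

theorem finite_setOf_supNorm_lt (d : ℕ) (t : ℝ) :
    {z : Fin d → ℤ | supNorm (intVec z) < t}.Finite := by
  refine (Set.finite_Icc (fun _ => -⌈t⌉ : Fin d → ℤ) (fun _ => ⌈t⌉)).subset fun z hz => ?_
  have h : ∀ i, |z i| ≤ ⌈t⌉ := fun i => by
    have h1 : |(z i : ℝ)| < t := (abs_le_supNorm (intVec z) i).trans_lt hz
    have h2 : ((|z i| : ℤ) : ℝ) ≤ (⌈t⌉ : ℤ) := by
      push_cast
      exact h1.le.trans (Int.le_ceil t)
    exact_mod_cast h2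
  exact ⟨fun i => (abs_le.mp (h i)).1, fun i => (abs_le.mp (h i)).2⟩

/-- `V` is approximated by integer points to order at most `γ`. -/
def ApproxBound {d : ℕ} (V : Submodule ℝ (EuclideanSpace ℝ (Fin d))) (γ : ℝ) : Prop :=
  ∃ κ : ℝ, 0 < κ ∧ ∀ z : Fin d → ℤ, z ≠ 0 →
    κ * supNorm (intVec z) ^ (-γ) ≤
      Metric.infDist (intVec z) (V : Set (EuclideanSpace ℝ (Fin d)))

theorem psiSub_le {d : ℕ} (V : Submodule ℝ (EuclideanSpace ℝ (Fin d))) {t : ℝ}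
    {z : Fin d → ℤ} (hz : z ≠ 0) (ht : supNorm (intVec z) < t) :
    psiSub V t ≤ Metric.infDist (intVec z) (V : Set (EuclideanSpace ℝ (Fin d))) := by
  refine csInf_le ⟨0, ?_⟩ ⟨z, ⟨one_le_supNorm_intVec hz, ht⟩, rfl⟩
  rintro _ ⟨z, -, rfl⟩
  exact Metric.infDist_nonneg

theorem exists_ne_zero_supNorm_eq_one {d : ℕ} (hd : 0 < d) :
    ∃ z : Fin d → ℤ, z ≠ 0 ∧ ‖intVec z‖ = 1 ∧ supNorm (intVec z) = 1 := by
  let z : Fin d → ℤ := Pi.single ⟨0, hd⟩ 1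
  have h0 : z ≠ 0 := by simp [z]
  have h1 : intVec z = EuclideanSpace.single ⟨0, hd⟩ 1 := by
    ext i
    simp [z, Pi.single_apply]
  have h2 : ‖intVec z‖ = 1 := by rw [h1]; simp
  exact ⟨z, h0, h2, le_antisymm (h2 ▸ supNorm_le_norm _) (one_le_supNorm_intVec h0)⟩

theorem zero_le_diophExp {d : ℕ} (hd : 0 < d) (V : Submodule ℝ (EuclideanSpace ℝ (Fin d))) :
    0 ≤ diophExp V := by
  refine le_sSup ⟨0, by simp, ?_⟩
  obtain ⟨z, hz, hz1, hz2⟩ := exists_ne_zero_supNorm_eq_one hd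
  refine lt_of_le_of_lt (b := (1 : ENNReal)) ?_ (by simp)
  refine liminf_le_of_frequently_le' (Eventually.frequently ?_)
  filter_upwards [eventually_gt_atTop 1] with t ht
  rw [Real.rpow_zero, one_mul]
  refine ENNReal.ofReal_le_one.mpr ((psiSub_le V hz (hz2 ▸ ht)).trans ?_)
  rw [← hz1]
  simpa using Metric.infDist_le_dist_of_mem (x := intVec z) V.zero_mem

theorem approxBound_of_diophExp_lt {d : ℕ} {V : Submodule ℝ (EuclideanSpace ℝ (Fin d))} {γ : ℝ}
    (h : diophExp V < γ) : ApproxBound V γ := by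
  have hlim : 1 < liminf (fun t : ℝ => ENNReal.ofReal (t ^ γ * psiSub V t)) atTop := by
    by_contra hcon
    refine not_le.mpr h (le_sSup ⟨γ, rfl, (not_lt.mp hcon).trans_lt (by simp)⟩)
  obtain ⟨T, hT⟩ := eventually_atTop.mp
    ((eventually_lt_of_lt_liminf hlim).and (eventually_ge_atTop 1))
  have hT0 : 0 < T := zero_lt_one.trans_le (hT T le_rfl).2
  refine ⟨(2 * T) ^ (-γ), by positivity, fun z hz => ?_⟩
  have hN := one_le_supNorm_intVec hz
  set N := supNorm (intVec z)
  have hT1 := (hT T le_rfl).2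
  have h1 : N < 2 * T * N := by nlinarith
  have h2 := (hT (2 * T * N) (by nlinarith)).1
  rw [ENNReal.one_lt_ofReal] at h2
  have hpos : 0 < 2 * T * N := by positivity
  rw [← Real.mul_rpow (by positivity) (by positivity)]
  refine le_trans ?_ (psiSub_le V hz h1)
  rw [Real.rpow_neg hpos.le, inv_le_iff_one_le_mul₀' (by positivity)]
  exact h2.le

theorem diophExp_le_of_approxBound {d : ℕ} (hd : 0 < d)
    {V : Submodule ℝ (EuclideanSpace ℝ (Fin d))} {γ : ℝ} (hγ : 0 ≤ γ)
    (h : ApproxBound V γ) : diophExp V ≤ γ := by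
  obtain ⟨κ, hκ, h⟩ := h
  refine sSup_le ?_
  rintro _ ⟨γ₂, rfl, hlim⟩
  rw [EReal.coe_le_coe_iff]
  by_contra! hlt
  refine hlim.ne (Tendsto.liminf_eq (ENNReal.tendsto_ofReal_atTop.comp ?_))
  refine tendsto_atTop_mono' atTop ?_
    ((tendsto_rpow_atTop (sub_pos.mpr hlt)).const_mul_atTop hκ)
  filter_upwards [eventually_gt_atTop 1] with t ht
  have ht0 : 0 < t := zero_lt_one.trans ht
  have hψ : κ * t ^ (-γ) ≤ psiSub V t := by
    obtain ⟨z, hz, -, hz2⟩ := exists_ne_zero_supNorm_eq_one hd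
    refine le_csInf ⟨_, z, ⟨hz2.ge, hz2 ▸ ht⟩, rfl⟩ ?_
    rintro _ ⟨z, ⟨hz, hzt⟩, rfl⟩
    refine le_trans ?_ (h z (ne_zero_of_one_le_supNorm hz))
    exact mul_le_mul_of_nonneg_left
      (Real.rpow_le_rpow_of_nonpos (by linarith) hzt.le (by linarith)) hκ.le
  calc κ * t ^ (γ₂ - γ) = t ^ γ₂ * (κ * t ^ (-γ)) := by
        rw [sub_eq_add_neg, Real.rpow_add ht0]; ring
    _ ≤ t ^ γ₂ * psiSub V t := mul_le_mul_of_nonneg_left hψ (by positivity)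

/-- A slab intersected with a box has volume controlled by the width of the slab. -/
theorem volume_slab_inter_box_le {c : ℕ} (L : ℝ) (hL : 0 ≤ L) (x : Fin c → ℝ) (j : Fin c)
    (y r ρ : ℝ)
    (hr : 0 ≤ r) (hρ : 0 < ρ) (hx : ρ ≤ |x j|) :
    volume {θ : Fin c → ℝ | (∀ k, |θ k| ≤ L) ∧ |y - ∑ k, θ k * x k| ≤ r} ≤
      ENNReal.ofReal ((2 * L + 1) ^ c * (2 * r / ρ)) := by
  have hxj : x j ≠ 0 := abs_pos.mp (hρ.trans_le hx)
  let M : Matrix (Fin c) (Fin c) ℝ := (1 : Matrix (Fin c) (Fin c) ℝ).updateRow j x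
  have hdet : M.det = x j := by
    rw [← Matrix.cramer_transpose_apply, Matrix.transpose_one, Matrix.cramer_one]; rfl
  have hdet' : LinearMap.det (Matrix.toLin' M) = x j := by rw [LinearMap.det_toLin', hdet]
  let I : Fin c → Set ℝ := Function.update (fun _ => Set.Icc (-L) L) j (Set.Icc (y - r) (y + r))
  have hsub : {θ : Fin c → ℝ | (∀ k, |θ k| ≤ L) ∧ |y - ∑ k, θ k * x k| ≤ r} ⊆
      Matrix.toLin' M ⁻¹' Set.univ.pi I := by
    rintro θ ⟨h1, h2⟩ k -
    by_cases hk : k = j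
    · subst hk
      have h3 : (Matrix.toLin' M θ) k = ∑ i, θ i * x i := by
        simp [M, Matrix.mulVec, dotProduct, mul_comm]
      simp only [I, Function.update_self, h3, Set.mem_Icc]
      constructor <;> linarith [abs_le.mp h2]
    · have h3 : (Matrix.toLin' M θ) k = θ k := by
        simp [M, Matrix.mulVec, dotProduct, Matrix.updateRow_ne hk, Matrix.one_apply]
      simp only [I, Function.update_of_ne hk, h3, Set.mem_Icc]
      exact abs_le.mp (h1 k)
  refine (measure_mono hsub).trans ?_
  rw [Measure.addHaar_preimage_linearMap _ (by rw [hdet']; exact hxj), hdet', volume_pi_pi]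
  have hprod : ∏ k, volume (I k) ≤ ENNReal.ofReal ((2 * L + 1) ^ c * (2 * r)) := by
    rw [← Finset.mul_prod_erase _ _ (Finset.mem_univ j), mul_comm ((2 * L + 1) ^ c),
      ENNReal.ofReal_mul (by positivity)]
    refine mul_le_mul' ?_ ?_
    · simp only [I, Function.update_self, Real.volume_Icc]
      exact ENNReal.ofReal_le_ofReal (by linarith)
    · calc ∏ k ∈ Finset.univ.erase j, volume (I k)
          ≤ ∏ k ∈ Finset.univ.erase j, ENNReal.ofReal (2 * L + 1) := by
            refine Finset.prod_le_prod' fun k hk => ?_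
            simp only [I, Function.update_of_ne (Finset.ne_of_mem_erase hk), Real.volume_Icc]
            exact ENNReal.ofReal_le_ofReal (by linarith)
        _ = ENNReal.ofReal ((2 * L + 1) ^ (c - 1)) := by
            rw [Finset.prod_const, Finset.card_erase_of_mem (Finset.mem_univ j),
              ENNReal.ofReal_pow (by linarith)]
            simp
        _ ≤ ENNReal.ofReal ((2 * L + 1) ^ c) :=
            ENNReal.ofReal_le_ofReal (pow_le_pow_right₀ (by linarith) (Nat.sub_le c 1))
  refine (mul_le_mul' le_rfl hprod).trans ?_
  rw [← ENNReal.ofReal_mul (abs_nonneg _)]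
  refine ENNReal.ofReal_le_ofReal ?_
  have : |(x j)⁻¹| ≤ ρ⁻¹ := by rw [abs_inv]; exact inv_anti₀ hρ hx
  calc |(x j)⁻¹| * ((2 * L + 1) ^ c * (2 * r)) ≤ ρ⁻¹ * ((2 * L + 1) ^ c * (2 * r)) :=
        mul_le_mul_of_nonneg_right this (by positivity)
    _ = _ := by ring

theorem volume_slabs_le {c n : ℕ} (L : ℝ) (hL : 0 ≤ L) (x : Fin c → ℝ) (j : Fin c)
    (y : Fin n → ℝ) (r ρ : ℝ) (hr : 0 ≤ r) (hρ : 0 < ρ) (hx : ρ ≤ |x j|) :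
    volume {Θ : Fin n → Fin c → ℝ |
        (∀ i k, |Θ i k| ≤ L) ∧ ∀ i, |y i - ∑ k, Θ i k * x k| ≤ r} ≤
      ENNReal.ofReal (((2 * L + 1) ^ c * (2 * r / ρ)) ^ n) := by
  have heq : {Θ : Fin n → Fin c → ℝ |
        (∀ i k, |Θ i k| ≤ L) ∧ ∀ i, |y i - ∑ k, Θ i k * x k| ≤ r} =
      Set.univ.pi fun i => {θ | (∀ k, |θ k| ≤ L) ∧ |y i - ∑ k, θ k * x k| ≤ r} := by
    ext Θ
    simp [forall_and]
  rw [heq, volume_pi_pi, ENNReal.ofReal_pow (by positivity)]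
  refine (Finset.prod_le_prod' fun i _ =>
    volume_slab_inter_box_le L hL x j (y i) r ρ hr hρ hx).trans ?_
  simp

/-- A vector close to a graph subspace almost satisfies its defining equations, and if it is
nonzero its first coordinates are not all small. -/
theorem graphSub_coord_bounds {d a c : ℕ} (hca : c < a)
    {e : Fin a → EuclideanSpace ℝ (Fin d)} (he : Orthonormal ℝ e) {L : ℝ} (hL : 0 ≤ L)
    {Θ : Fin (a - c) → Fin c → ℝ} (hΘ : ∀ i k, |Θ i k| ≤ L)
    {w : EuclideanSpace ℝ (Fin d)} {ε : ℝ}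
    (hw : Metric.infDist w (graphSub d a c hca.le e Θ : Set (EuclideanSpace ℝ (Fin d))) ≤ ε) :
    (∀ i : Fin (a - c), |inner ℝ (e ⟨c + i.1, by have := i.2; omega⟩) w -
        ∑ k, Θ i k * inner ℝ (e (Fin.castLE hca.le k)) w| ≤ (1 + c * L) * ε) ∧
    ∀ ρ : ℝ, (∀ k : Fin c, |inner ℝ (e (Fin.castLE hca.le k)) w| ≤ ρ) →
      ‖w‖ ≤ ε + (1 + a * L) * (c * (ρ + ε)) := by
  obtain ⟨v, hv, hvd⟩ := (Submodule.closed_of_finiteDimensional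
    (graphSub d a c hca.le e Θ)).exists_infDist_eq_dist ⟨0, zero_mem _⟩ w
  rw [hvd, dist_eq_norm] at hw
  have hgraph : ∃ x : Fin c → ℝ,
      v = (∑ j : Fin c, x j • e (Fin.castLE hca.le j)) +
        ∑ i : Fin (a - c), (∑ j : Fin c, Θ i j * x j) • e ⟨c + i.1, by have := i.2; omega⟩ := by
    refine Submodule.span_induction (fun v hv => hv) ⟨0, by simp⟩ ?_ ?_ hv
    · rintro _ _ - - ⟨x, rfl⟩ ⟨x', rfl⟩
      refine ⟨x + x', ?_⟩
      simp only [Pi.add_apply, add_smul, mul_add, Finset.sum_add_distrib]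
      abel
    · rintro r _ - ⟨x, rfl⟩
      refine ⟨r • x, ?_⟩
      simp only [Pi.smul_apply, smul_eq_mul, smul_add, Finset.smul_sum, smul_smul, Finset.mul_sum,
        mul_left_comm]
  obtain ⟨x, hx⟩ := hgraph
  have hinner : ∀ i j, inner ℝ (e i) (e j) = if i = j then (1 : ℝ) else 0 :=
    orthonormal_iff_ite.mp he
  have hx1 : ∀ k : Fin c, inner ℝ (e (Fin.castLE hca.le k)) v = x k := by
    intro k
    rw [hx, inner_add_right, inner_sum, inner_sum]
    have h0 : ∀ i : Fin (a - c), ¬ (k.1 = c + i.1) := fun i => by have := k.2; omega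
    simp [inner_smul_right, hinner, Fin.ext_iff, h0]
    simp [← Fin.ext_iff]
  have hx2 : ∀ i : Fin (a - c), inner ℝ (e ⟨c + i.1, by have := i.2; omega⟩) v =
      ∑ k, Θ i k * x k := by
    intro i
    rw [hx, inner_add_right, inner_sum, inner_sum]
    have h0 : ∀ k : Fin c, ¬ (c + i.1 = k.1) := fun k => by have := k.2; omega
    simp [inner_smul_right, hinner, Fin.ext_iff, h0]
    simp [← Fin.ext_iff]
  have hclose : ∀ i, |inner ℝ (e i) w - inner ℝ (e i) v| ≤ ε := by
    intro i
    rw [← inner_sub_right]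
    refine (abs_real_inner_le_norm _ _).trans ?_
    rw [he.1 i, one_mul]
    exact hw
  have hε : 0 ≤ ε := (norm_nonneg _).trans hw
  constructor
  · intro i
    have h1 := hclose ⟨c + i.1, by have := i.2; omega⟩
    rw [hx2] at h1
    have h2 : |∑ k, Θ i k * (x k - inner ℝ (e (Fin.castLE hca.le k)) w)| ≤ c * (L * ε) := by
      refine (Finset.abs_sum_le_sum_abs _ _).trans
        ((Finset.sum_le_sum (g := fun _ => L * ε) fun k _ => ?_).trans (by simp))
      rw [abs_mul]
      refine mul_le_mul (hΘ i k) ?_ (abs_nonneg _) hL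
      rw [← hx1 k, abs_sub_comm]
      exact hclose _
    have h3 := abs_add_le (inner ℝ (e ⟨c + i.1, by have := i.2; omega⟩) w - ∑ k, Θ i k * x k)
      (∑ k, Θ i k * (x k - inner ℝ (e (Fin.castLE hca.le k)) w))
    simp only [mul_sub, Finset.sum_sub_distrib, sub_add_sub_cancel] at h3 h2
    linarith
  · intro ρ hρ
    have hxb : ∀ k, |x k| ≤ ρ + ε := fun k => by
      have h1 := hclose (Fin.castLE hca.le k)
      rw [hx1, abs_sub_comm] at h1
      have h2 := abs_add_le (x k - inner ℝ (e (Fin.castLE hca.le k)) w)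
        (inner ℝ (e (Fin.castLE hca.le k)) w)
      rw [sub_add_cancel] at h2
      linarith [hρ k]
    have hsum : ∑ k, |x k| ≤ c * (ρ + ε) :=
      (Finset.sum_le_sum fun k _ => hxb k).trans (by simp [mul_add])
    have hv1 : ‖∑ j : Fin c, x j • e (Fin.castLE hca.le j)‖ ≤ ∑ k, |x k| :=
      (norm_sum_le _ _).trans (by simp [norm_smul, he.1])
    have hv2 : ‖∑ i : Fin (a - c), (∑ j : Fin c, Θ i j * x j) •
        e ⟨c + i.1, by have := i.2; omega⟩‖ ≤ a * L * ∑ k, |x k| := by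
      have h1 : ∀ i : Fin (a - c), ‖(∑ j : Fin c, Θ i j * x j) •
          e ⟨c + i.1, by have := i.2; omega⟩‖ ≤ L * ∑ k, |x k| := fun i => by
        rw [norm_smul, he.1, mul_one, Real.norm_eq_abs, Finset.mul_sum]
        refine (Finset.abs_sum_le_sum_abs _ _).trans (Finset.sum_le_sum fun k _ => ?_)
        rw [abs_mul]
        exact mul_le_mul_of_nonneg_right (hΘ i k) (abs_nonneg _)
      refine (norm_sum_le _ _).trans ((Finset.sum_le_sum fun i _ => h1 i).trans ?_)
      have h2 : ((a - c : ℕ) : ℝ) ≤ a := by exact_mod_cast Nat.sub_le a c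
      have h3 : 0 ≤ L * ∑ k, |x k| := mul_nonneg hL (Finset.sum_nonneg fun _ _ => abs_nonneg _)
      simp only [Finset.sum_const, Finset.card_univ, Fintype.card_fin, nsmul_eq_mul]
      nlinarith
    have hvn : ‖v‖ ≤ (1 + a * L) * ∑ k, |x k| := by
      rw [hx]
      refine (norm_add_le _ _).trans ?_
      linarith
    have hwv : ‖w‖ ≤ ‖w - v‖ + ‖v‖ := by simpa using norm_add_le (w - v) v
    have h4 : (1 + a * L) * ∑ k, |x k| ≤ (1 + a * L) * (c * (ρ + ε)) :=
      mul_le_mul_of_nonneg_left hsum (by positivity)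
    linarith

/-- Vectors of norm at most `X` that lie near `A` and are separated modulo `B`
are few in number. -/
theorem card_le_of_separated_mod {d a b : ℕ} (A B : Submodule ℝ (EuclideanSpace ℝ (Fin d)))
    (hBA : B ≤ A) (hdimB : Module.finrank ℝ B = b) (hdimA : Module.finrank ℝ A = a)
    (F : Finset (Fin d → ℤ)) (X ε δ : ℝ) (hX0 : 0 ≤ X) (hδ : 0 < δ) (hε : ε ≤ δ / 4)
    (hX : ∀ z ∈ F, ‖intVec z‖ ≤ X)
    (hA : ∀ z ∈ F, Metric.infDist (intVec z) (A : Set (EuclideanSpace ℝ (Fin d))) ≤ ε)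
    (hB : ∀ z ∈ F, ∀ z' ∈ F, z ≠ z' →
      δ ≤ Metric.infDist (intVec (z - z')) (B : Set (EuclideanSpace ℝ (Fin d)))) :
    (F.card : ℝ) ≤ (8 * (a + 1) * (X + δ) / δ + 3) ^ (a - b) := by
  classical
  have hclosest : ∀ z : Fin d → ℤ, ∃ u ∈ A,
      Metric.infDist (intVec z) (A : Set (EuclideanSpace ℝ (Fin d))) = dist (intVec z) u := fun z =>
    (Submodule.closed_of_finiteDimensional A).exists_infDist_eq_dist ⟨0, zero_mem _⟩ _
  choose u huA hu using hclosest
  let V := Bᗮ ⊓ A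
  have hV : Module.finrank ℝ V = a - b := by
    have := Submodule.finrank_add_inf_finrank_orthogonal hBA
    simp only [V]
    omega
  let f := (stdOrthonormalBasis ℝ V).reindex (finCongr hV)
  let s := δ / (4 * (a + 1))
  have hs : 0 < s := by positivity
  let g : (Fin d → ℤ) → Fin (a - b) → ℤ := fun z i =>
    ⌊inner ℝ (f i : EuclideanSpace ℝ (Fin d)) (u z) / s⌋
  have hf1 : ∀ i, ‖(f i : EuclideanSpace ℝ (Fin d))‖ = 1 := fun i => f.orthonormal.1 i
  have hinj : Set.InjOn g F := by
    intro z hz z' hz' hg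
    by_contra hne
    have hsep := hB z hz z' hz' hne
    let q := u z - u z'
    have hq : q ∈ A := A.sub_mem (huA z) (huA z')
    let p : EuclideanSpace ℝ (Fin d) := B.starProjection q
    have hp : p ∈ B := B.starProjection_apply_mem q
    have hr : q - p ∈ V := ⟨B.sub_starProjection_mem_orthogonal q, A.sub_mem hq (hBA hp)⟩
    have hcoord : ∀ i, |inner ℝ (f i : EuclideanSpace ℝ (Fin d)) (q - p)| ≤ s := by
      intro i
      have h1 : inner ℝ (f i : EuclideanSpace ℝ (Fin d)) p = 0 := by
        rw [real_inner_comm]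
        exact (f i).2.1 p hp
      rw [inner_sub_right, h1, sub_zero, inner_sub_right]
      have h2 := Int.abs_sub_lt_one_of_floor_eq_floor (congrFun hg i)
      rw [← sub_div, abs_div, abs_of_pos hs, div_lt_one hs] at h2
      exact h2.le
    have hnorm : ‖q - p‖ ≤ (a - b : ℕ) * s := by
      change ‖(⟨q - p, hr⟩ : V)‖ ≤ _
      rw [← f.sum_repr ⟨q - p, hr⟩]
      refine (norm_sum_le _ _).trans
        ((Finset.sum_le_sum (g := fun _ => s) fun i _ => ?_).trans (by simp))
      rw [norm_smul, f.orthonormal.1 i, mul_one, f.repr_apply_apply]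
      exact hcoord i
    have hms : ((a - b : ℕ) : ℝ) * s ≤ δ / 4 := by
      have h1 : ((a - b : ℕ) : ℝ) ≤ a + 1 := by
        have : ((a - b : ℕ) : ℝ) ≤ a := by exact_mod_cast Nat.sub_le a b
        linarith
      calc ((a - b : ℕ) : ℝ) * s ≤ (a + 1) * s := mul_le_mul_of_nonneg_right h1 hs.le
        _ = δ / 4 := by simp only [s]; field_simp
    have h1 := Metric.infDist_le_dist_of_mem (x := intVec (z - z')) hp
    have h2 : dist (intVec (z - z')) p ≤ dist (intVec z) (u z) + dist (intVec z') (u z') +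
        ‖q - p‖ := by
      rw [dist_eq_norm, dist_eq_norm, dist_eq_norm, intVec_sub]
      have h3 : intVec z - intVec z' - p =
          (intVec z - u z) - (intVec z' - u z') + (q - p) := by simp only [q]; abel
      rw [h3]
      exact (norm_add_le _ _).trans (add_le_add (norm_sub_le _ _) le_rfl)
    rw [← hu, ← hu] at h2
    linarith [hA z hz, hA z' hz']
  let Q : ℤ := ⌈(X + δ) / s⌉
  have hmaps : ∀ z ∈ F, g z ∈ Fintype.piFinset fun _ : Fin (a - b) => Finset.Icc (-Q) Q := by
    intro z hz
    rw [Fintype.mem_piFinset]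
    intro i
    have h1 : |inner ℝ (f i : EuclideanSpace ℝ (Fin d)) (u z)| ≤ X + δ := by
      refine (abs_real_inner_le_norm _ _).trans ?_
      rw [hf1, one_mul]
      have h2 : ‖u z‖ ≤ ‖intVec z‖ + ‖intVec z - u z‖ := by
        simpa using norm_sub_le (intVec z) (intVec z - u z)
      rw [← dist_eq_norm, ← hu] at h2
      linarith [hX z hz, hA z hz]
    have h2 : |inner ℝ (f i : EuclideanSpace ℝ (Fin d)) (u z) / s| ≤ Q := by
      rw [abs_div, abs_of_pos hs]
      exact (div_le_div_of_nonneg_right h1 hs.le).trans (Int.le_ceil _)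
    rw [abs_le] at h2
    rw [Finset.mem_Icc]
    refine ⟨Int.le_floor.mpr (by push_cast; exact h2.1), ?_⟩
    exact_mod_cast (Int.floor_le _).trans h2.2
  have hcard := Finset.card_le_card_of_injOn g hmaps hinj
  have hQ0 : 0 ≤ Q := Int.ceil_nonneg (by positivity)
  have hQ : ((2 * Q + 1 : ℤ) : ℝ) ≤ 8 * (a + 1) * (X + δ) / δ + 3 := by
    have h1 : (Q : ℝ) < (X + δ) / s + 1 := Int.ceil_lt_add_one _
    have h2 : (X + δ) / s = 4 * (a + 1) * (X + δ) / δ := by simp only [s]; field_simp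
    have h3 : 8 * (a + 1) * (X + δ) / δ = 2 * (4 * (a + 1) * (X + δ) / δ) := by ring
    push_cast
    linarith
  have hcard2 : (F.card : ℝ) ≤ ((2 * Q + 1 : ℤ) : ℝ) ^ (a - b) := by
    have h1 : (Fintype.piFinset fun _ : Fin (a - b) => Finset.Icc (-Q) Q).card =
        (2 * Q + 1).toNat ^ (a - b) := by
      rw [Fintype.card_piFinset]
      simp only [Int.card_Icc, Finset.prod_const, Finset.card_univ, Fintype.card_fin]
      congr 2
      ring
    rw [h1] at hcard
    have h2 : (((2 * Q + 1).toNat : ℤ) : ℝ) = ((2 * Q + 1 : ℤ) : ℝ) := by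
      rw [Int.toNat_of_nonneg (by omega)]
    rw [← h2]
    exact_mod_cast hcard
  exact hcard2.trans (pow_le_pow_left₀ (by positivity) hQ _)

theorem graphSub_le_span {d a c : ℕ} (hca : c ≤ a) (e : Fin a → EuclideanSpace ℝ (Fin d))
    (Θ : Fin (a - c) → Fin c → ℝ) :
    graphSub d a c hca e Θ ≤ Submodule.span ℝ (Set.range e) := by
  refine Submodule.span_le.mpr ?_
  rintro _ ⟨x, rfl⟩
  have h : ∀ i, e i ∈ Submodule.span ℝ (Set.range e) := fun i =>
    Submodule.subset_span ⟨i, rfl⟩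
  exact add_mem (sum_mem fun j _ => Submodule.smul_mem _ _ (h _))
    (sum_mem fun j _ => Submodule.smul_mem _ _ (h _))

theorem infDist_smul_le {d : ℕ} (V : Submodule ℝ (EuclideanSpace ℝ (Fin d))) (r : ℝ)
    (w : EuclideanSpace ℝ (Fin d)) :
    Metric.infDist (r • w) (V : Set (EuclideanSpace ℝ (Fin d))) ≤ |r| * Metric.infDist w V := by
  obtain ⟨v, hv, hvd⟩ := (Submodule.closed_of_finiteDimensional V).exists_infDist_eq_dist
    ⟨0, zero_mem _⟩ w
  refine (Metric.infDist_le_dist_of_mem (V.smul_mem r hv)).trans ?_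
  rw [hvd, dist_smul₀, Real.norm_eq_abs]

/-- The set of matrices in a box whose graph passes near a given vector has small measure. -/
theorem volume_graphSub_near_le {d a c : ℕ} (hca : c < a)
    {e : Fin a → EuclideanSpace ℝ (Fin d)} (he : Orthonormal ℝ e) {L : ℝ} (hL : 0 ≤ L)
    {w : EuclideanSpace ℝ (Fin d)} {R ρ ε : ℝ} (hρ : 0 < ρ) (hε : ε ≤ ρ)
    (hR : 4 * (1 + (1 + a * L) * c) * ρ ≤ R) (hw : R ≤ ‖w‖) :
    volume {Θ : Fin (a - c) → Fin c → ℝ | (∀ i k, |Θ i k| ≤ L) ∧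
        Metric.infDist w (graphSub d a c hca.le e Θ : Set (EuclideanSpace ℝ (Fin d))) ≤ ε} ≤
      ENNReal.ofReal (((2 * L + 1) ^ c * (2 * ((1 + c * L) * ε) / ρ)) ^ (a - c)) := by
  rcases Set.eq_empty_or_nonempty {Θ : Fin (a - c) → Fin c → ℝ | (∀ i k, |Θ i k| ≤ L) ∧
      Metric.infDist w (graphSub d a c hca.le e Θ : Set (EuclideanSpace ℝ (Fin d))) ≤ ε}
    with h | ⟨Θ₀, hΘ₀, hd₀⟩
  · rw [h]
    simp
  have hε0 : 0 ≤ ε := Metric.infDist_nonneg.trans hd₀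
  have hex : ∃ j : Fin c, ρ < |inner ℝ (e (Fin.castLE hca.le j)) w| := by
    by_contra! hcon
    have h1 := (graphSub_coord_bounds hca he hL hΘ₀ hd₀).2 ρ hcon
    have h2 : (1 + a * L) * (c * (ρ + ε)) ≤ (1 + a * L) * (c * (ρ + ρ)) := by gcongr
    have h3 : 0 ≤ (1 + a * L) * c * ρ := by positivity
    nlinarith
  obtain ⟨j, hj⟩ := hex
  refine (measure_mono ?_).trans (volume_slabs_le L hL
    (fun k => inner ℝ (e (Fin.castLE hca.le k)) w) j
    (fun i => inner ℝ (e ⟨c + i.1, by have := i.2; omega⟩) w) ((1 + c * L) * ε) ρ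
    (by positivity) hρ hj.le)
  exact fun Θ hΘ => ⟨hΘ.1, (graphSub_coord_bounds hca he hL hΘ.1 hΘ.2).1⟩

/-- The integer points with sup-norm in `[R, 2R)` and within `ε` of `V`. -/
def dyadicNear {d : ℕ} (V : Submodule ℝ (EuclideanSpace ℝ (Fin d))) (R ε : ℝ) :
    Set (Fin d → ℤ) :=
  {z | R ≤ supNorm (intVec z) ∧ supNorm (intVec z) < 2 * R ∧
    Metric.infDist (intVec z) (V : Set (EuclideanSpace ℝ (Fin d))) ≤ ε}

theorem finite_dyadicNear {d : ℕ} (V : Submodule ℝ (EuclideanSpace ℝ (Fin d))) (R ε : ℝ) :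
    (dyadicNear V R ε).Finite :=
  (finite_setOf_supNorm_lt d (2 * R)).subset fun _ hz => hz.2.1

/-- If all large dyadic shells avoid the `η R ^ (-γ)`-neighbourhood of `V`,
then `V` satisfies an approximation bound of order `γ`. -/
theorem approxBound_of_eventually_dyadicNear {d : ℕ}
    {V : Submodule ℝ (EuclideanSpace ℝ (Fin d))} {γ η : ℝ} (hγ : 0 ≤ γ) (hη : 0 < η)
    (h : ∀ᶠ k : ℕ in atTop, dyadicNear V (2 ^ k) (η * ((2 : ℝ) ^ k) ^ (-γ)) = ∅) :
    ApproxBound V γ := by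
  obtain ⟨k₀, hk₀⟩ := eventually_atTop.mp h
  refine ⟨η * ((2 : ℝ) ^ k₀) ^ (-γ) / 2 ^ k₀, by positivity, fun z hz => ?_⟩
  have hN := one_le_supNorm_intVec hz
  have hz₁ : intVec (2 ^ k₀ • z) = (2 : ℝ) ^ k₀ • intVec z := by
    rw [intVec_nsmul]
    push_cast
    rfl
  have hN₁ : supNorm (intVec (2 ^ k₀ • z)) = 2 ^ k₀ * supNorm (intVec z) := by
    rw [hz₁, supNorm_smul, abs_of_pos (by positivity)]
  have hle : (2 : ℝ) ^ k₀ ≤ 2 ^ k₀ * supNorm (intVec z) :=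
    le_mul_of_one_le_right (by positivity) hN
  obtain ⟨k, hk1, hk2⟩ := exists_nat_pow_near (y := (2 : ℝ))
    ((one_le_pow₀ one_le_two).trans hle) one_lt_two
  have hkk : k₀ ≤ k :=
    Nat.lt_succ_iff.mp ((pow_lt_pow_iff_right₀ (one_lt_two (α := ℝ))).mp (hle.trans_lt hk2))
  have hfar : η * ((2 : ℝ) ^ k) ^ (-γ) <
      Metric.infDist (intVec (2 ^ k₀ • z)) (V : Set (EuclideanSpace ℝ (Fin d))) := by
    by_contra! hcon
    refine Set.eq_empty_iff_forall_notMem.mp (hk₀ k hkk) (2 ^ k₀ • z) ⟨?_, ?_, hcon⟩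
    · rw [hN₁]; exact hk1
    · rw [hN₁, ← pow_succ']; exact hk2
  have hscale := infDist_smul_le V ((2 : ℝ) ^ k₀) (intVec z)
  rw [abs_of_pos (by positivity), ← hz₁] at hscale
  have hmono : (2 ^ k₀ * supNorm (intVec z)) ^ (-γ) ≤ ((2 : ℝ) ^ k) ^ (-γ) :=
    Real.rpow_le_rpow_of_nonpos (by positivity) hk1 (by linarith)
  rw [Real.mul_rpow (by positivity) (by positivity)] at hmono
  rw [div_mul_eq_mul_div, div_le_iff₀' (by positivity), mul_assoc]
  exact (mul_le_mul_of_nonneg_left hmono hη.le).trans (hfar.le.trans hscale)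

/-- A subspace `B` with an approximation bound limits the number of integer points of a dyadic
shell lying near a larger subspace `A`. -/
theorem card_dyadicNear_le {d a b : ℕ} {A B : Submodule ℝ (EuclideanSpace ℝ (Fin d))}
    (hBA : B ≤ A) (hdimB : Module.finrank ℝ B = b) (hdimA : Module.finrank ℝ A = a)
    {γ κ : ℝ} (hγ : 0 ≤ γ) (hκ : 0 < κ)
    (hB : ∀ z : Fin d → ℤ, z ≠ 0 → κ * supNorm (intVec z) ^ (-γ) ≤
      Metric.infDist (intVec z) (B : Set (EuclideanSpace ℝ (Fin d))))
    {R ε : ℝ} (hR : 1 ≤ R) (hε : ε ≤ κ * 4 ^ (-γ) / 4 * R ^ (-γ)) :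
    ((finite_dyadicNear A R ε).toFinset.card : ℝ) ≤
      ((8 * (a + 1) * (2 * d / (κ * 4 ^ (-γ)) + 1) + 3) * R ^ (1 + γ)) ^ (a - b) := by
  have hR0 : 0 < R := zero_lt_one.trans_le hR
  have h4 : (0 : ℝ) < 4 ^ (-γ) := by positivity
  have hδ : 0 < κ * 4 ^ (-γ) * R ^ (-γ) := by positivity
  have hcard := card_le_of_separated_mod A B hBA hdimB hdimA
    (finite_dyadicNear A R ε).toFinset (d * (2 * R)) ε (κ * 4 ^ (-γ) * R ^ (-γ))
    (by positivity) hδ (by linarith) ?_ ?_ ?_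
  · refine hcard.trans (pow_le_pow_left₀ (by positivity) ?_ _)
    have hpow : (1 : ℝ) ≤ R ^ (1 + γ) := Real.one_le_rpow hR (by linarith)
    have h1 : 8 * (a + 1) * (d * (2 * R) + κ * 4 ^ (-γ) * R ^ (-γ)) / (κ * 4 ^ (-γ) * R ^ (-γ)) =
        8 * (a + 1) * (2 * d / (κ * 4 ^ (-γ)) * R ^ (1 + γ) + 1) := by
      rw [Real.rpow_add hR0, Real.rpow_one, Real.rpow_neg hR0.le]
      have : R ^ γ ≠ 0 := by positivity
      field_simp
    rw [h1]
    have h2 : (0 : ℝ) ≤ 8 * (a + 1) := by positivity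
    nlinarith
  · intro z hz
    rw [Set.Finite.mem_toFinset] at hz
    exact (norm_le_mul_supNorm _).trans (mul_le_mul_of_nonneg_left hz.2.1.le (by positivity))
  · intro z hz
    rw [Set.Finite.mem_toFinset] at hz
    exact hz.2.2
  · intro z hz z' hz' hne
    rw [Set.Finite.mem_toFinset] at hz hz'
    have hsub := sub_ne_zero.mpr hne
    refine le_trans ?_ (hB _ hsub)
    rw [mul_assoc, ← Real.mul_rpow (by norm_num) hR0.le]
    refine mul_le_mul_of_nonneg_left (Real.rpow_le_rpow_of_nonpos
      (zero_lt_one.trans_le (one_le_supNorm_intVec hsub)) ?_ (by linarith)) hκ.le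
    rw [intVec_sub]
    linarith [supNorm_sub_le (intVec z) (intVec z'), hz.2.1, hz'.2.1]

/-- Almost every graph over a bounded parameter range inherits an approximation bound from `B`,
with the exponent dictated by the dimensions. -/
theorem ae_approxBound_graphSub {d a b c : ℕ} (hca : c < a)
    {A B : Submodule ℝ (EuclideanSpace ℝ (Fin d))} (hBA : B ≤ A)
    (hdimB : Module.finrank ℝ B = b) (hdimA : Module.finrank ℝ A = a)
    {e : Fin a → EuclideanSpace ℝ (Fin d)} (he : Orthonormal ℝ e)
    (hspan : Submodule.span ℝ (Set.range e) = A) {γ γ' : ℝ} (hγ : 0 ≤ γ) (hγγ' : γ ≤ γ')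
    (hexp : (1 + γ) * (a - b : ℕ) < (1 + γ') * (a - c : ℕ)) (hB : ApproxBound B γ)
    {L : ℝ} (hL : 0 ≤ L) :
    ∀ᵐ Θ ∂(volume : Measure (Fin (a - c) → Fin c → ℝ)),
      (∀ i k, |Θ i k| ≤ L) → ApproxBound (graphSub d a c hca.le e Θ) γ' := by
  obtain ⟨κ, hκ, hB⟩ := hB
  have h4 : (0 : ℝ) < 4 ^ (-γ) := by positivity
  set M : ℝ := 4 * (1 + (1 + a * L) * c) with hM
  have hM0 : 0 < M := by positivity
  set η : ℝ := min (1 / M) (κ * 4 ^ (-γ) / 4) with hη_def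
  have hη : 0 < η := lt_min (by positivity) (by positivity)
  set K₁ : ℝ := 8 * (a + 1) * (2 * d / (κ * 4 ^ (-γ)) + 1) + 3 with hK₁
  have hK₁0 : 0 < K₁ := by positivity
  set K₂ : ℝ := (2 * L + 1) ^ c * (2 * ((1 + c * L) * η) * M) with hK₂
  have hK₂0 : 0 < K₂ := by positivity
  set s : ℝ := (1 + γ) * (a - b : ℕ) - (1 + γ') * (a - c : ℕ) with hs
  let T : ℕ → Set (Fin (a - c) → Fin c → ℝ) := fun k =>
    ⋃ z ∈ (finite_dyadicNear A (2 ^ k) (η * ((2 : ℝ) ^ k) ^ (-γ'))).toFinset,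
      {Θ | (∀ i k, |Θ i k| ≤ L) ∧
        Metric.infDist (intVec z) (graphSub d a c hca.le e Θ : Set (EuclideanSpace ℝ (Fin d))) ≤
          η * ((2 : ℝ) ^ k) ^ (-γ')}
  have hT : ∀ k, volume (T k) ≤ ENNReal.ofReal (K₁ ^ (a - b) * K₂ ^ (a - c) * (2 ^ s) ^ k) := by
    intro k
    have hR : (1 : ℝ) ≤ 2 ^ k := one_le_pow₀ one_le_two
    have hkey : ((2 : ℝ) ^ s) ^ k = ((2 : ℝ) ^ k) ^ s := by
      rw [← Real.rpow_natCast, ← Real.rpow_natCast, ← Real.rpow_mul zero_le_two,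
        ← Real.rpow_mul zero_le_two, mul_comm]
    rw [hkey]
    simp only [T]
    generalize (2 : ℝ) ^ k = R at hR
    have hR0 : 0 < R := zero_lt_one.trans_le hR
    have hcard := card_dyadicNear_le hBA hdimB hdimA hγ hκ hB (ε := η * R ^ (-γ')) hR
      (mul_le_mul (min_le_right _ _) (Real.rpow_le_rpow_of_exponent_le hR (by linarith))
        (by positivity) (by positivity))
    rw [← hK₁] at hcard
    refine (measure_biUnion_finset_le _ _).trans ((Finset.sum_le_sum
      (g := fun _ => ENNReal.ofReal ((K₂ * R ^ (-(1 + γ'))) ^ (a - c))) fun z hz => ?_).trans ?_)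
    · rw [Set.Finite.mem_toFinset] at hz
      have hρ : η * R ^ (-γ') ≤ R / M := by
        have h1 : R ^ (-γ') ≤ 1 := Real.rpow_le_one_of_one_le_of_nonpos hR (by linarith)
        calc η * R ^ (-γ') ≤ (1 / M) * 1 :=
              mul_le_mul (min_le_left _ _) h1 (by positivity) (by positivity)
          _ ≤ R / M := by rw [mul_one]; gcongr
      refine (volume_graphSub_near_le hca he hL (div_pos hR0 hM0) hρ (R := R) ?_
        (hz.1.trans (supNorm_le_norm _))).trans (le_of_eq ?_)
      · rw [← hM, mul_div_cancel₀ _ hM0.ne']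
      · congr 2
        rw [hK₂, neg_add, Real.rpow_add hR0, Real.rpow_neg_one]
        field_simp
    · rw [Finset.sum_const, nsmul_eq_mul, ← ENNReal.ofReal_natCast,
        ← ENNReal.ofReal_mul (Nat.cast_nonneg _)]
      refine ENNReal.ofReal_le_ofReal
        ((mul_le_mul_of_nonneg_right hcard (by positivity)).trans (le_of_eq ?_))
      have hpow : R ^ s = (R ^ (1 + γ)) ^ (a - b) * (R ^ (-(1 + γ'))) ^ (a - c) := by
        rw [← Real.rpow_natCast (R ^ (1 + γ)), ← Real.rpow_natCast (R ^ (-(1 + γ'))),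
          ← Real.rpow_mul hR0.le, ← Real.rpow_mul hR0.le, ← Real.rpow_add hR0, hs]
        congr 1
        ring
      rw [hpow, mul_pow, mul_pow]
      ring
  have hsum : ∑' k, volume (T k) ≠ ⊤ := by
    have hgeo : Summable fun k : ℕ => K₁ ^ (a - b) * K₂ ^ (a - c) * ((2 : ℝ) ^ s) ^ k :=
      (summable_geometric_of_lt_one (by positivity)
        (Real.rpow_lt_one_of_one_lt_of_neg one_lt_two (by linarith))).mul_left _
    exact ne_top_of_le_ne_top hgeo.tsum_ofReal_ne_top (ENNReal.tsum_le_tsum hT)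
  filter_upwards [ae_eventually_notMem hsum] with Θ hΘ hbox
  refine approxBound_of_eventually_dyadicNear (hγ.trans hγγ') hη ?_
  filter_upwards [hΘ] with k hk
  refine Set.eq_empty_iff_forall_notMem.mpr fun z hz => hk ?_
  refine Set.mem_biUnion (x := z) ?_ ⟨hbox, hz.2.2⟩
  rw [SetLike.mem_coe, Set.Finite.mem_toFinset]
  refine ⟨hz.1, hz.2.1, (Metric.infDist_le_infDist_of_subset ?_ ⟨0, zero_mem _⟩).trans hz.2.2⟩
  exact hspan ▸ graphSub_le_span hca.le e Θ

/-- if `B ⊆ A ⊆ ℝ^d` with `dim B = b`, `dim A = a`, `1 ≤ b ≤ c < a ≤ d`,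
`b < d`, and the Diophantine exponent of `B` equals the finite real number `ω`, then for
almost every `Θ` the graph subspace `C(Θ) ⊆ A` satisfies
`ω(C(Θ)) ≤ ω + (ω+1)(c−b)/(a−c)`. -/
theorem stmt_1 (d a b c : ℕ) (hd : 2 ≤ d) (hb : 1 ≤ b) (hbc : b ≤ c) (hca : c < a)
    (had : a ≤ d) (hbd : b < d)
    (A B : Submodule ℝ (EuclideanSpace ℝ (Fin d))) (hBA : B ≤ A)
    (hdimB : Module.finrank ℝ B = b) (hdimA : Module.finrank ℝ A = a)
    (e : Fin a → EuclideanSpace ℝ (Fin d)) (he : Orthonormal ℝ e)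
    (hspan : Submodule.span ℝ (Set.range e) = A)
    (ω : ℝ) (hω : diophExp B = (ω : EReal)) :
    ∀ᵐ Θ ∂(volume : Measure (Fin (a - c) → Fin c → ℝ)),
      diophExp (graphSub d a c (by omega) e Θ) ≤
        ((ω + (ω + 1) * ((c : ℝ) - (b : ℝ)) / ((a : ℝ) - (c : ℝ)) : ℝ) : EReal) := by
  have hd0 : 0 < d := by omega
  have hω0 : 0 ≤ ω := by
    have := zero_le_diophExp hd0 B
    rw [hω] at this
    exact_mod_cast this
  have hac : (0 : ℝ) < (a : ℝ) - c := sub_pos.mpr (by exact_mod_cast hca)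
  have hcb : (0 : ℝ) ≤ (c : ℝ) - b := sub_nonneg.mpr (by exact_mod_cast hbc)
  have hab : (0 : ℝ) < (a : ℝ) - b := by linarith
  set ω' : ℝ := ω + (ω + 1) * ((c : ℝ) - b) / ((a : ℝ) - c) with hω'
  have hω'_eq : (1 + ω') * ((a : ℝ) - c) = (1 + ω) * ((a : ℝ) - b) := by
    rw [hω']
    field_simp
    ring
  have key : ∀ γ' : ℝ, ω' < γ' → ∀ L : ℝ, 0 ≤ L →
      ∀ᵐ Θ ∂(volume : Measure (Fin (a - c) → Fin c → ℝ)),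
        (∀ i k, |Θ i k| ≤ L) → diophExp (graphSub d a c (by omega) e Θ) ≤ (γ' : EReal) := by
    intro γ' hγ' L hL
    have hlt : 1 + ω < (1 + γ') * ((a : ℝ) - c) / ((a : ℝ) - b) := by
      rw [lt_div_iff₀ hab, ← hω'_eq]
      exact mul_lt_mul_of_pos_right (by linarith) hac
    obtain ⟨γ, hγ1, hγ2⟩ := exists_between hlt
    rw [lt_div_iff₀ hab] at hγ2
    have hγγ' : γ - 1 ≤ γ' := by
      have hω'0 : 0 ≤ ω' := by positivity
      nlinarith
    have hexp : (1 + (γ - 1)) * (a - b : ℕ) < (1 + γ') * (a - c : ℕ) := by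
      rw [Nat.cast_sub (by omega), Nat.cast_sub hca.le]
      linarith
    have hB : ApproxBound B (γ - 1) := approxBound_of_diophExp_lt (by
      rw [hω]
      exact_mod_cast (by linarith : ω < γ - 1))
    filter_upwards [ae_approxBound_graphSub hca hBA hdimB hdimA he hspan (by linarith) hγγ'
      hexp hB hL] with Θ hΘ hbox
    exact diophExp_le_of_approxBound hd0 (by linarith) (hΘ hbox)
  have hall : ∀ᵐ Θ ∂(volume : Measure (Fin (a - c) → Fin c → ℝ)), ∀ n L : ℕ,
      (∀ i k, |Θ i k| ≤ (L : ℝ)) →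
        diophExp (graphSub d a c (by omega) e Θ) ≤ ((ω' + 1 / ((n : ℝ) + 1) : ℝ) : EReal) :=
    ae_all_iff.mpr fun n => ae_all_iff.mpr fun L =>
      key _ (lt_add_of_pos_right _ (by positivity)) L (Nat.cast_nonneg L)
  filter_upwards [hall] with Θ hΘ
  obtain ⟨L, hL⟩ := exists_nat_ge ‖Θ‖
  have hbox : ∀ i k, |Θ i k| ≤ (L : ℝ) := fun i k =>
    ((norm_le_pi_norm (Θ i) k).trans (norm_le_pi_norm Θ i)).trans hL
  refine EReal.le_of_forall_lt_iff_le.mp fun y hy => ?_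
  obtain ⟨n, hn⟩ := exists_nat_one_div_lt (sub_pos.mpr (EReal.coe_lt_coe_iff.mp hy))
  refine (hΘ n L hbox).trans (EReal.coe_le_coe_iff.mpr ?_)
  linarith

end
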